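/- For every C > 0 there exists C' > 0 such that for every infinitely differentiable compactly supported a : ℝ → ℝ with ‖a‖_{H¹} ≤ C, one has |F(Q+a) − F(Q) − (1/2)·(∫_ℝ a'(x)² dx + ∫_ℝ a(x)² dx − p·∫_ℝ Q(x)^(p−1)·a(x)² dx)| ≤ C'·‖a‖_{H¹}³. -/

import Mathlib

/-- The soliton profile `Q(x) = ((p+1)/(2 cosh²(((p−1)/2)x)))^(1/(p−1))`. -/
noncomputable def Q (p : ℕ) (x : ℝ) : ℝ :=
  (((p : ℝ) + 1) / (2 * Real.cosh ((((p : ℝ) - 1) / 2) * x) ^ 2)) ^ (1 / ((p : ℝ) - 1))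

/-- Weinstein's functional `F(φ) = E(φ) + (1/2)∫φ²`, where
`E(φ) = (1/2)∫φ'² − (1/(p+1))∫φ^(p+1)`. -/
noncomputable def Fw (p : ℕ) (φ : ℝ → ℝ) : ℝ :=
  (1 / 2) * (∫ x : ℝ, deriv φ x ^ 2) - (1 / ((p : ℝ) + 1)) * (∫ x : ℝ, φ x ^ (p + 1))
    + (1 / 2) * (∫ x : ℝ, φ x ^ 2)

/-- The `H¹` norm: `‖a‖² = ∫a² + ∫a'²`. -/
noncomputable def H1norm (a : ℝ → ℝ) : ℝ :=
  Real.sqrt ((∫ x : ℝ, a x ^ 2) + ∫ x : ℝ, deriv a x ^ 2)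

open MeasureTheory Real

/-- Uniform cubic bound on the second-order Taylor remainder of `z ↦ z ^ (n + 2)`. -/
lemma exists_abs_add_pow_sub_taylor_le (n : ℕ) {M N : ℝ} (hM : 0 ≤ M) (hN : 0 ≤ N) :
    ∃ K : ℝ, 0 ≤ K ∧ ∀ q a : ℝ, |q| ≤ M → |a| ≤ N →
      |(q + a) ^ (n + 2) - q ^ (n + 2) - (n + 2) * (q ^ (n + 1) * a)
        - (n + 2) * (n + 1) / 2 * (q ^ n * a ^ 2)| ≤ K * |a| ^ 3 := by
  induction n with
  | zero =>
    refine ⟨0, le_rfl, fun q a _ _ => le_of_eq ?_⟩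
    rw [zero_mul, abs_eq_zero]
    push_cast
    ring
  | succ n ih =>
    obtain ⟨K, hK, h⟩ := ih
    refine ⟨(M + N) * K + ((n : ℝ) + 2) * (n + 1) / 2 * M ^ n, by positivity,
      fun q a hq ha => ?_⟩
    have key : (q + a) ^ (n + 1 + 2) - q ^ (n + 1 + 2)
          - (((n + 1 : ℕ) : ℝ) + 2) * (q ^ (n + 1 + 1) * a)
          - (((n + 1 : ℕ) : ℝ) + 2) * (((n + 1 : ℕ) : ℝ) + 1) / 2 * (q ^ (n + 1) * a ^ 2)
        = (q + a) * ((q + a) ^ (n + 2) - q ^ (n + 2) - (n + 2) * (q ^ (n + 1) * a)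
            - (n + 2) * (n + 1) / 2 * (q ^ n * a ^ 2))
          + ((n : ℝ) + 2) * (n + 1) / 2 * q ^ n * a ^ 3 := by
      push_cast
      ring
    rw [key, add_mul _ _ (|a| ^ 3)]
    refine (abs_add_le _ _).trans (add_le_add ?_ ?_)
    · rw [abs_mul, mul_assoc]
      exact mul_le_mul ((abs_add_le _ _).trans (add_le_add hq ha)) (h q a hq ha)
        (abs_nonneg _) (by positivity)
    · rw [abs_mul, abs_mul, abs_pow, abs_pow, abs_of_nonneg (by positivity : (0 : ℝ) ≤
        ((n : ℝ) + 2) * (n + 1) / 2)]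
      gcongr

section Soliton

variable {p : ℕ}

lemma Q_pos (p : ℕ) (x : ℝ) : 0 < Q p x := by
  have := cosh_pos (((p : ℝ) - 1) / 2 * x)
  unfold Q
  positivity

lemma Q_pow_sub_one (hp : 2 ≤ p) (x : ℝ) :
    Q p x ^ (p - 1) = ((p : ℝ) + 1) / (2 * cosh (((p : ℝ) - 1) / 2 * x) ^ 2) := by
  have := cosh_pos (((p : ℝ) - 1) / 2 * x)
  have h := rpow_inv_natCast_pow
    (by positivity : 0 ≤ ((p : ℝ) + 1) / (2 * cosh (((p : ℝ) - 1) / 2 * x) ^ 2))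
    (by lia : p - 1 ≠ 0)
  rw [Nat.cast_sub (by lia), Nat.cast_one, inv_eq_one_div] at h
  exact h

lemma hasDerivAt_cosh_const_mul (k x : ℝ) :
    HasDerivAt (fun y => cosh (k * y)) (k * sinh (k * x)) x := by
  have := (hasDerivAt_cosh (k * x)).comp x ((hasDerivAt_id x).const_mul k)
  simpa [mul_comm, Function.comp_def] using this

lemma hasDerivAt_sinh_const_mul (k x : ℝ) :
    HasDerivAt (fun y => sinh (k * y)) (k * cosh (k * x)) x := by
  have := (hasDerivAt_sinh (k * x)).comp x ((hasDerivAt_id x).const_mul k)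
  simpa [mul_comm, Function.comp_def] using this

lemma hasDerivAt_Q (hp : 2 ≤ p) (x : ℝ) :
    HasDerivAt (Q p)
      (-(sinh (((p : ℝ) - 1) / 2 * x) / cosh (((p : ℝ) - 1) / 2 * x)) * Q p x) x := by
  have hp' : (0 : ℝ) < (p : ℝ) - 1 := by
    have : (2 : ℝ) ≤ p := by exact_mod_cast hp
    linarith
  have hc := cosh_pos (((p : ℝ) - 1) / 2 * x)
  have hA : 0 < ((p : ℝ) + 1) / (2 * cosh (((p : ℝ) - 1) / 2 * x) ^ 2) := by positivity
  have h := ((((hasDerivAt_cosh_const_mul (((p : ℝ) - 1) / 2) x).pow 2).const_mul 2).fun_inv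
    (mul_pos two_pos (pow_pos hc 2)).ne').const_mul ((p : ℝ) + 1)
  simp only [← div_eq_mul_inv, Pi.pow_apply] at h
  have h2 := h.rpow_const (p := 1 / ((p : ℝ) - 1)) (Or.inl hA.ne')
  refine h2.congr_deriv ?_
  rw [rpow_sub_one hA.ne', Q]
  push_cast
  field_simp

lemma deriv_Q (hp : 2 ≤ p) : deriv (Q p) = fun x =>
    -(sinh (((p : ℝ) - 1) / 2 * x) / cosh (((p : ℝ) - 1) / 2 * x)) * Q p x :=
  funext fun x => (hasDerivAt_Q hp x).deriv

/-- The soliton equation `Q'' = Q - Q ^ p`. -/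
lemma hasDerivAt_deriv_Q (hp : 2 ≤ p) (x : ℝ) :
    HasDerivAt (deriv (Q p)) (Q p x - Q p x ^ p) x := by
  have hc := cosh_pos (((p : ℝ) - 1) / 2 * x)
  rw [deriv_Q hp]
  have h := (((hasDerivAt_sinh_const_mul (((p : ℝ) - 1) / 2) x).fun_div
    (hasDerivAt_cosh_const_mul (((p : ℝ) - 1) / 2) x) hc.ne').fun_neg).fun_mul (hasDerivAt_Q hp x)
  refine h.congr_deriv ?_
  have e : Q p x ^ p = Q p x ^ (p - 1) * Q p x := by
    rw [← pow_succ, Nat.sub_add_cancel (by lia)]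
  rw [e, Q_pow_sub_one hp]
  have hsq := sinh_sq (((p : ℝ) - 1) / 2 * x)
  set c := cosh (((p : ℝ) - 1) / 2 * x)
  set s := sinh (((p : ℝ) - 1) / 2 * x)
  field_simp
  rw [hsq]
  ring

lemma continuous_Q (hp : 2 ≤ p) : Continuous (Q p) :=
  continuous_iff_continuousAt.2 fun x => (hasDerivAt_Q hp x).continuousAt

lemma continuous_deriv_Q (hp : 2 ≤ p) : Continuous (deriv (Q p)) :=
  continuous_iff_continuousAt.2 fun x => (hasDerivAt_deriv_Q hp x).continuousAt

lemma sq_deriv_Q_le (hp : 2 ≤ p) (x : ℝ) : deriv (Q p) x ^ 2 ≤ Q p x ^ 2 := by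
  rw [deriv_Q hp, mul_pow, neg_sq, div_pow]
  refine mul_le_of_le_one_left (sq_nonneg _) ?_
  have hc := cosh_pos (((p : ℝ) - 1) / 2 * x)
  rw [div_le_one (by positivity), sinh_sq]
  linarith

lemma exp_abs_le_two_mul_cosh (x : ℝ) : exp |x| ≤ 2 * cosh x := by
  rw [← cosh_abs, cosh_eq]
  linarith [exp_pos (-|x|)]

lemma Q_le_exp (hp : 2 ≤ p) :
    ∃ K : ℝ, 0 ≤ K ∧ ∀ x, Q p x ≤ K * exp (-|x|) := by
  have hp' : (0 : ℝ) < (p : ℝ) - 1 := by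
    have : (2 : ℝ) ≤ p := by exact_mod_cast hp
    linarith
  refine ⟨(2 * ((p : ℝ) + 1)) ^ (1 / ((p : ℝ) - 1)), by positivity, fun x => ?_⟩
  have e : exp (-|x|) = exp (-(((p : ℝ) - 1) * |x|)) ^ (1 / ((p : ℝ) - 1)) := by
    rw [← exp_mul]
    congr 1
    field_simp
  rw [e, ← mul_rpow (by positivity) (exp_pos _).le, Q]
  have hc := cosh_pos (((p : ℝ) - 1) / 2 * x)
  refine rpow_le_rpow (by positivity) ?_ (by positivity)
  have h := pow_le_pow_left₀ (exp_pos _).le (exp_abs_le_two_mul_cosh (((p : ℝ) - 1) / 2 * x)) 2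
  rw [← exp_nat_mul, abs_mul, abs_of_pos (by positivity : 0 < ((p : ℝ) - 1) / 2)] at h
  have e2 : ((2 : ℕ) : ℝ) * (((p : ℝ) - 1) / 2 * |x|) = ((p : ℝ) - 1) * |x| := by
    push_cast
    ring
  rw [e2] at h
  rw [exp_neg, ← div_eq_mul_inv, div_le_div_iff₀ (by positivity) (exp_pos _)]
  have hp1 : (0 : ℝ) ≤ (p : ℝ) + 1 := by positivity
  nlinarith [mul_le_mul_of_nonneg_left h hp1]

lemma exists_Q_le (hp : 2 ≤ p) : ∃ M : ℝ, 0 ≤ M ∧ ∀ x, Q p x ≤ M := by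
  obtain ⟨K, hK, h⟩ := Q_le_exp hp
  exact ⟨K, hK, fun x => (h x).trans (mul_le_of_le_one_right hK (by simp))⟩

lemma integrable_Q (hp : 2 ≤ p) : Integrable (Q p) := by
  obtain ⟨K, hK, h⟩ := Q_le_exp hp
  refine (integrable_inv_one_add_sq.const_mul (K * 2)).mono'
    (continuous_Q hp).aestronglyMeasurable (.of_forall fun x => ?_)
  rw [norm_of_nonneg (Q_pos p x).le, mul_assoc]
  refine (h x).trans (mul_le_mul_of_nonneg_left ?_ hK)
  rw [exp_neg, ← div_eq_mul_inv, inv_le_comm₀ (exp_pos _) (by positivity), inv_div]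
  have := quadratic_le_exp_of_nonneg (abs_nonneg x)
  rw [sq_abs] at this
  linarith [abs_nonneg x]

lemma integrable_Q_pow (hp : 2 ≤ p) (n : ℕ) : Integrable (fun x => Q p x ^ (n + 1)) := by
  obtain ⟨M, hM, h⟩ := exists_Q_le hp
  refine ((integrable_Q hp).const_mul (M ^ n)).mono'
    ((continuous_Q hp).pow _).aestronglyMeasurable (.of_forall fun x => ?_)
  have := Q_pos p x
  rw [norm_of_nonneg (by positivity), pow_succ]
  gcongr
  exact h x

lemma integrable_deriv_Q_sq (hp : 2 ≤ p) : Integrable (fun x => deriv (Q p) x ^ 2) :=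
  (integrable_Q_pow hp 1).mono' ((continuous_deriv_Q hp).pow 2).aestronglyMeasurable
    (.of_forall fun x => by
      rw [norm_of_nonneg (sq_nonneg _)]
      exact sq_deriv_Q_le hp x)

end Soliton

section Sobolev

variable {a : ℝ → ℝ}

lemma H1norm_sq (a : ℝ → ℝ) :
    H1norm a ^ 2 = (∫ x : ℝ, a x ^ 2) + ∫ x : ℝ, deriv a x ^ 2 :=
  sq_sqrt (add_nonneg (integral_nonneg fun _ => sq_nonneg _)
    (integral_nonneg fun _ => sq_nonneg _))

lemma integrable_mul_of_hasCompactSupport {f g : ℝ → ℝ} (hf : Continuous f) (hg : Continuous g)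
    (hgs : HasCompactSupport g) : Integrable (fun x => f x * g x) :=
  (hf.mul hg).integrable_of_hasCompactSupport hgs.mul_left

/-- The Sobolev embedding `H¹(ℝ) ⊂ L∞(ℝ)`. -/
lemma abs_le_H1norm (ha : ContDiff ℝ 1 a) (hs : HasCompactSupport a) (x : ℝ) :
    |a x| ≤ H1norm a := by
  have hd : ∀ y, HasDerivAt a (deriv a y) y := fun y =>
    (ha.differentiable one_ne_zero y).hasDerivAt
  have hc := ha.continuous
  have hc' := ha.continuous_deriv le_rfl
  have i1 := integrable_mul_of_hasCompactSupport hc hc hs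
  have i2 := integrable_mul_of_hasCompactSupport hc' hc' hs.deriv
  have i3 := integrable_mul_of_hasCompactSupport hc hc' hs.deriv
  have e : deriv (fun y => a y * a y) = fun y => 2 * (a y * deriv a y) :=
    funext fun y => (((hd y).fun_mul (hd y)).congr_deriv (by ring)).deriv
  have h := HasCompactSupport.integral_Iic_deriv_eq (ha.mul ha) (hs.mul_left (f := a)) x
  refine abs_le_of_sq_le_sq ?_ (sqrt_nonneg _)
  rw [H1norm_sq, ← integral_add (by simpa only [sq] using i1) (by simpa only [sq] using i2)]
  calc a x ^ 2 = ∫ y in Set.Iic x, 2 * (a y * deriv a y) := by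
        rw [sq, ← e]
        exact h.symm
    _ ≤ ∫ y in Set.Iic x, (a y ^ 2 + deriv a y ^ 2) :=
        integral_mono (i3.const_mul 2).integrableOn
          (by simpa only [sq] using (i1.fun_add i2).restrict)
          fun y => by nlinarith [sq_nonneg (a y - deriv a y)]
    _ ≤ ∫ y, (a y ^ 2 + deriv a y ^ 2) :=
        setIntegral_le_integral (by simpa only [sq] using i1.fun_add i2)
          (.of_forall fun y => by positivity)

lemma integral_abs_pow_three_le (ha : ContDiff ℝ 1 a) (hs : HasCompactSupport a) :
    ∫ x, |a x| ^ 3 ≤ H1norm a ^ 3 := by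
  have i1 := integrable_mul_of_hasCompactSupport ha.continuous ha.continuous hs
  simp only [← sq] at i1
  calc ∫ x, |a x| ^ 3 ≤ ∫ x, H1norm a * a x ^ 2 := by
        refine integral_mono_of_nonneg (.of_forall fun x => by positivity) (i1.const_mul _)
          (.of_forall fun x => ?_)
        have : |a x| ^ 3 = |a x| * a x ^ 2 := by rw [← sq_abs]; ring
        simp only [this]
        gcongr
        exact abs_le_H1norm ha hs x
    _ = H1norm a * ∫ x, a x ^ 2 := integral_const_mul _ _
    _ ≤ H1norm a * H1norm a ^ 2 := by
        refine mul_le_mul_of_nonneg_left ?_ (sqrt_nonneg _)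
        rw [H1norm_sq]
        exact le_add_of_nonneg_right (integral_nonneg fun _ => sq_nonneg _)
    _ = H1norm a ^ 3 := by ring

end Sobolev

/-- Weak form of the soliton equation. -/
lemma integral_deriv_Q_mul_deriv {p : ℕ} (hp : 2 ≤ p) {a : ℝ → ℝ} (ha : ContDiff ℝ 1 a)
    (hs : HasCompactSupport a) :
    (∫ x, deriv (Q p) x * deriv a x) + ∫ x, Q p x * a x = ∫ x, Q p x ^ p * a x := by
  have hQ := continuous_Q hp
  have hc := ha.continuous
  have j1 := integrable_mul_of_hasCompactSupport (continuous_deriv_Q hp)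
    (ha.continuous_deriv le_rfl) hs.deriv
  have j2 := integrable_mul_of_hasCompactSupport hQ hc hs
  have j3 := integrable_mul_of_hasCompactSupport (hQ.pow p) hc hs
  simp only [Pi.pow_apply] at j3
  have h := integral_eq_zero_of_hasDerivAt_of_integrable (f := fun x => deriv (Q p) x * a x)
    (f' := fun x => deriv (Q p) x * deriv a x + Q p x * a x - Q p x ^ p * a x)
    (fun x => ((hasDerivAt_deriv_Q hp x).fun_mul
      (ha.differentiable one_ne_zero x).hasDerivAt).congr_deriv (by ring))
    ((j1.fun_add j2).sub j3)
    (integrable_mul_of_hasCompactSupport (continuous_deriv_Q hp) hc hs)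
  rw [integral_sub (j1.fun_add j2) j3, integral_add j1 j2] at h
  linarith

lemma Fw_Q_add_sub {p : ℕ} (hp : 2 ≤ p) {a : ℝ → ℝ} (ha : ContDiff ℝ 1 a)
    (hs : HasCompactSupport a) :
    Integrable (fun x => (Q p x + a x) ^ (p + 1) - Q p x ^ (p + 1)
        - (p + 1) * (Q p x ^ p * a x) - (p + 1) * p / 2 * (Q p x ^ (p - 1) * a x ^ 2)) ∧
    Fw p (fun x => Q p x + a x) - Fw p (Q p)
          - (1 / 2) * ((∫ x : ℝ, deriv a x ^ 2) + (∫ x : ℝ, a x ^ 2)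
              - (p : ℝ) * ∫ x : ℝ, Q p x ^ (p - 1) * a x ^ 2)
      = -(1 / ((p : ℝ) + 1)) * ∫ x, ((Q p x + a x) ^ (p + 1) - Q p x ^ (p + 1)
        - (p + 1) * (Q p x ^ p * a x) - (p + 1) * p / 2 * (Q p x ^ (p - 1) * a x ^ 2)) := by
  have hQ := continuous_Q hp
  have hQ' := continuous_deriv_Q hp
  have hc := ha.continuous
  have hc' := ha.continuous_deriv le_rfl
  have hs2 : HasCompactSupport (fun x => a x ^ 2) :=
    hs.comp_left (g := fun y : ℝ => y ^ 2) (by simp)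
  have hs2' : HasCompactSupport (fun x => deriv a x ^ 2) :=
    hs.deriv.comp_left (g := fun y : ℝ => y ^ 2) (by simp)
  have ia : Integrable (fun x => a x ^ 2) := (hc.pow 2).integrable_of_hasCompactSupport hs2
  have ia' : Integrable (fun x => deriv a x ^ 2) :=
    (hc'.pow 2).integrable_of_hasCompactSupport hs2'
  have iQa := integrable_mul_of_hasCompactSupport hQ hc hs
  have iQa' := integrable_mul_of_hasCompactSupport hQ' hc' hs.deriv
  have iL : Integrable (fun x => Q p x ^ p * a x) :=
    integrable_mul_of_hasCompactSupport (hQ.pow p) hc hs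
  have iB : Integrable (fun x => Q p x ^ (p - 1) * a x ^ 2) :=
    integrable_mul_of_hasCompactSupport (hQ.pow (p - 1)) (hc.pow 2) hs2
  have iQ := integrable_Q_pow hp p
  have iQ2 := integrable_Q_pow hp 1
  have iQ2' := integrable_deriv_Q_sq hp
  have iD : Integrable (fun x => (Q p x + a x) ^ (p + 1) - Q p x ^ (p + 1)) := by
    refine Continuous.integrable_of_hasCompactSupport (by fun_prop) (hs.mono fun x hx => ?_)
    contrapose! hx
    simp_all
  have iP : Integrable (fun x => (Q p x + a x) ^ (p + 1)) :=
    (iD.add iQ).congr (.of_forall fun x => by simp)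
  have iDL : Integrable (fun x => (Q p x + a x) ^ (p + 1) - Q p x ^ (p + 1)
      - ((p : ℝ) + 1) * (Q p x ^ p * a x)) := iD.sub (iL.const_mul _)
  refine ⟨iDL.sub (iB.const_mul _), ?_⟩
  have ed : deriv (fun x => Q p x + a x) = fun x => deriv (Q p) x + deriv a x :=
    funext fun x => deriv_fun_add (hasDerivAt_Q hp x).differentiableAt
      (ha.differentiable one_ne_zero x)
  have e1 : ∫ x, (deriv (Q p) x + deriv a x) ^ 2 = (∫ x, deriv (Q p) x ^ 2)
      + 2 * (∫ x, deriv (Q p) x * deriv a x) + ∫ x, deriv a x ^ 2 := by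
    rw [← integral_const_mul, ← integral_add iQ2' (iQa'.const_mul 2),
      ← integral_add (iQ2'.fun_add (iQa'.const_mul 2)) ia']
    exact integral_congr_ae (.of_forall fun x => by simp only []; ring)
  have e2 : ∫ x, (Q p x + a x) ^ 2 = (∫ x, Q p x ^ 2)
      + 2 * (∫ x, Q p x * a x) + ∫ x, a x ^ 2 := by
    rw [← integral_const_mul, ← integral_add iQ2 (iQa.const_mul 2),
      ← integral_add (iQ2.fun_add (iQa.const_mul 2)) ia]
    exact integral_congr_ae (.of_forall fun x => by simp only []; ring)
  have e3 := integral_deriv_Q_mul_deriv hp ha hs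
  rw [integral_sub iDL (iB.const_mul _), integral_sub iD (iL.const_mul _),
    integral_sub iP iQ, integral_const_mul, integral_const_mul, ← e3]
  simp only [Fw]
  rw [ed, e1, e2]
  field_simp
  ring

/-- Expansion of Weinstein's functional around `Q`:
`|F(Q+a) − F(Q) − (1/2)(La,a)| ≤ C' ‖a‖_{H¹}³` for `‖a‖_{H¹} ≤ C`. -/
theorem stmt10 (p : ℕ) (hp : 2 ≤ p) (C : ℝ) (hC : 0 < C) :
    ∃ C' : ℝ, 0 < C' ∧ ∀ a : ℝ → ℝ, ContDiff ℝ (⊤ : ℕ∞) a → HasCompactSupport a →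
      H1norm a ≤ C →
      |Fw p (fun x => Q p x + a x) - Fw p (Q p)
          - (1 / 2) * ((∫ x : ℝ, deriv a x ^ 2) + (∫ x : ℝ, a x ^ 2)
              - (p : ℝ) * ∫ x : ℝ, Q p x ^ (p - 1) * a x ^ 2)|
        ≤ C' * H1norm a ^ 3 := by
  obtain ⟨M, hM, hQM⟩ := exists_Q_le hp
  obtain ⟨K, hK, hR⟩ := exists_abs_add_pow_sub_taylor_le (p - 1) hM hC.le
  refine ⟨K + 1, by positivity, fun a ha hs haC => ?_⟩
  have ha1 : ContDiff ℝ 1 a := ha.of_le (by exact_mod_cast le_top)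
  obtain ⟨iR, e⟩ := Fw_Q_add_sub hp ha1 hs
  rw [e, abs_mul, abs_neg, abs_of_pos (by positivity : 0 < 1 / ((p : ℝ) + 1))]
  have hn : 0 ≤ H1norm a := Real.sqrt_nonneg _
  have hs3 : HasCompactSupport (fun x => |a x| ^ 3) :=
    hs.mono fun x hx => by
      contrapose! hx
      simp_all
  have i3 : Integrable (fun x => |a x| ^ 3) :=
    (ha.continuous.abs.pow 3).integrable_of_hasCompactSupport hs3
  have hp1 : p - 1 + 1 = p := by lia
  have hp2 : p - 1 + 2 = p + 1 := by lia
  have hpc : ((p - 1 : ℕ) : ℝ) = (p : ℝ) - 1 := by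
    rw [Nat.cast_sub (by lia), Nat.cast_one]
  have hint : |∫ x, ((Q p x + a x) ^ (p + 1) - Q p x ^ (p + 1)
      - (p + 1) * (Q p x ^ p * a x) - (p + 1) * p / 2 * (Q p x ^ (p - 1) * a x ^ 2))|
      ≤ K * H1norm a ^ 3 := by
    refine (abs_integral_le_integral_abs).trans ((integral_mono iR.abs (i3.const_mul K)
      fun x => ?_).trans ?_)
    · have h := hR (Q p x) (a x) (by rw [abs_of_pos (Q_pos p x)]; exact hQM x)
        ((abs_le_H1norm ha1 hs x).trans haC)
      rw [hp1, hp2, hpc, show (p : ℝ) - 1 + 2 = p + 1 by ring, sub_add_cancel] at h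
      exact h
    · rw [integral_const_mul]
      exact mul_le_mul_of_nonneg_left (integral_abs_pow_three_le ha1 hs) hK
  have hle : 1 / ((p : ℝ) + 1) ≤ 1 := by
    rw [div_le_one (by positivity)]
    linarith [(Nat.cast_nonneg p : (0 : ℝ) ≤ p)]
  calc _ ≤ 1 * (K * H1norm a ^ 3) := mul_le_mul hle hint (abs_nonneg _) zero_le_one
    _ ≤ (K + 1) * H1norm a ^ 3 := by
      rw [one_mul]
      gcongr
      linarith
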